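/- arXiv:2012.12562 — 2 statements merged into one kernel-verified Lean document; each statement's English description precedes it below -/
import Mathlib

section
/- Let K be an entrywise positive m×n real matrix with n ≥ m ≥ 2 and rank(K) = m, let a ∈ ℝ^m, b ∈ ℝ^n be entrywise positive vectors with Σ_i a_i = Σ_j b_j = 1, and let (u*, v*) be a solution of the scaling problem. Then ϑ² ≥ δ₂, where δ₂ = (b_min / a_max) · (1 − a_max) / ((‖Kᵀ‖_∞/σ_min(K))² − b_min). -/
open Matrix

/-- The matrix H' = diag(v*/√b) Kᵀ diag(u*∘u*/a) K diag(v*/√b). -/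
noncomputable def Hmat' {m n : ℕ} (K : Matrix (Fin m) (Fin n) ℝ)
    (a : Fin m → ℝ) (b : Fin n → ℝ) (u : Fin m → ℝ) (v : Fin n → ℝ) :
    Matrix (Fin n) (Fin n) ℝ :=
  Matrix.diagonal (fun j => v j / Real.sqrt (b j)) * Kᵀ *
    Matrix.diagonal (fun i => u i * u i / a i) * K *
    Matrix.diagonal (fun j => v j / Real.sqrt (b j))

/-- ϑ² = sup of the Rayleigh quotient of H' over the orthogonal complement of √b. -/
noncomputable def thetaSq' {m n : ℕ} (K : Matrix (Fin m) (Fin n) ℝ)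
    (a : Fin m → ℝ) (b : Fin n → ℝ) (u : Fin m → ℝ) (v : Fin n → ℝ) : ℝ :=
  sSup {r : ℝ | ∃ w : Fin n → ℝ, w ≠ 0 ∧ (w ⬝ᵥ fun j => Real.sqrt (b j)) = 0 ∧
    r = w ⬝ᵥ (Hmat' K a b u v).mulVec w / (w ⬝ᵥ w)}

/-- Maximum absolute row-sum norm ‖K‖_∞. -/
noncomputable def normInfRow {m n : ℕ} (K : Matrix (Fin m) (Fin n) ℝ) : ℝ :=
  ⨆ i, ∑ j, |K i j|

/-- The smallest positive singular value of K. -/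
noncomputable def sigmaMin {m n : ℕ} (K : Matrix (Fin m) (Fin n) ℝ) : ℝ :=
  sInf {s : ℝ | 0 < s ∧ ∃ x : Fin n → ℝ, x ≠ 0 ∧ (Kᵀ * K).mulVec x = (s ^ 2) • x}

lemma sigmaMin_nonneg {m n : ℕ} (K : Matrix (Fin m) (Fin n) ℝ) : 0 ≤ sigmaMin K :=
  Real.sInf_nonneg fun _ hs => hs.1.le

lemma dotProduct_self_pos {n : ℕ} {w : Fin n → ℝ} (hw : w ≠ 0) : 0 < w ⬝ᵥ w :=
  lt_of_le_of_ne (Finset.sum_nonneg fun j _ => mul_self_nonneg (w j))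
    fun h => hw (dotProduct_self_eq_zero.1 h.symm)

/-- If the rows of `K` are linearly independent, `sigmaMin K` bounds `Kᵀ` from below. -/
lemma sigmaMin_sq_mul_le {m n : ℕ} (K : Matrix (Fin m) (Fin n) ℝ) (hrank : K.rank = m)
    (x : Fin m → ℝ) :
    sigmaMin K ^ 2 * (x ⬝ᵥ x) ≤ (Kᵀ *ᵥ x) ⬝ᵥ (Kᵀ *ᵥ x) := by
  have hinj : Function.Injective Kᵀ.mulVec := by
    rw [mulVec_injective_iff, col_transpose, linearIndependent_iff_card_eq_finrank_span,
      Set.finrank, ← rank_eq_finrank_span_row, hrank, Fintype.card_fin]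
  have hquad (y : Fin m → ℝ) : y ⬝ᵥ (K * Kᵀ) *ᵥ y = (Kᵀ *ᵥ y) ⬝ᵥ (Kᵀ *ᵥ y) := by
    rw [← mulVec_mulVec, dotProduct_mulVec, ← mulVec_transpose]
  have hA : (K * Kᵀ - sigmaMin K ^ 2 • (1 : Matrix (Fin m) (Fin m) ℝ)).IsHermitian := by
    simp [IsHermitian, conjTranspose_eq_transpose_of_trivial]
  have hpos : (K * Kᵀ - sigmaMin K ^ 2 • (1 : Matrix (Fin m) (Fin m) ℝ)).PosSemidef := by
    rw [hA.posSemidef_iff_eigenvalues_nonneg]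
    intro i
    set y : Fin m → ℝ := (hA.eigenvectorBasis i).ofLp
    set μ := hA.eigenvalues i
    have hy : y ≠ 0 := fun h =>
      hA.eigenvectorBasis.orthonormal.ne_zero i (by ext k; exact congrFun h k)
    have heig : (K * Kᵀ) *ᵥ y = (μ + sigmaMin K ^ 2) • y := by
      have h := hA.mulVec_eigenvectorBasis i
      rw [sub_mulVec, smul_mulVec, one_mulVec, sub_eq_iff_eq_add, ← add_smul] at h
      exact h
    have hKy : Kᵀ *ᵥ y ≠ 0 := fun h => hy (hinj (by simpa using h))
    have hlam : 0 < μ + sigmaMin K ^ 2 := by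
      have h := hquad y
      rw [heig, dotProduct_smul, smul_eq_mul] at h
      have h1 : 0 < y ⬝ᵥ y := dotProduct_self_pos hy
      have h2 : 0 < (Kᵀ *ᵥ y) ⬝ᵥ (Kᵀ *ᵥ y) := dotProduct_self_pos hKy
      rw [← h] at h2
      exact pos_of_mul_pos_left h2 h1.le
    have hle : sigmaMin K ≤ √(μ + sigmaMin K ^ 2) := by
      refine csInf_le ⟨0, fun s hs => hs.1.le⟩ ⟨Real.sqrt_pos.2 hlam, Kᵀ *ᵥ y, hKy, ?_⟩
      rw [mulVec_mulVec, Matrix.mul_assoc, ← mulVec_mulVec, heig, mulVec_smul,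
        Real.sq_sqrt hlam.le]
    have h := pow_le_pow_left₀ (sigmaMin_nonneg K) hle 2
    rw [Real.sq_sqrt hlam.le] at h
    change 0 ≤ μ
    linarith
  have h := hpos.dotProduct_mulVec_nonneg x
  rw [star_trivial, sub_mulVec, smul_mulVec, one_mulVec, dotProduct_sub, hquad,
    dotProduct_smul, smul_eq_mul] at h
  linarith

lemma dotProduct_Hmat'_mulVec {m n : ℕ} (K : Matrix (Fin m) (Fin n) ℝ)
    (a : Fin m → ℝ) (b : Fin n → ℝ) (u : Fin m → ℝ) (v w : Fin n → ℝ) :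
    w ⬝ᵥ Hmat' K a b u v *ᵥ w = ∑ i, (∑ j, u i * K i j * v j * (w j / √(b j))) ^ 2 / a i := by
  simp only [Hmat', Matrix.mul_assoc]
  rw [← mulVec_mulVec, ← mulVec_mulVec, ← mulVec_mulVec, dotProduct_mulVec, dotProduct_mulVec,
    ← mulVec_transpose, ← mulVec_transpose, diagonal_transpose, transpose_transpose,
    ← mulVec_mulVec]
  refine Finset.sum_congr rfl fun i _ => ?_
  have h : ∑ j, u i * K i j * v j * (w j / √(b j)) =
      u i * (K *ᵥ diagonal (fun j => v j / √(b j)) *ᵥ w) i := by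
    simp only [mulVec, dotProduct, diagonal, of_apply, Finset.mul_sum, ite_mul, zero_mul,
      Finset.sum_ite_eq, Finset.mem_univ, if_true]
    exact Finset.sum_congr rfl fun j _ => by ring
  rw [h, mulVec_diagonal]
  ring

lemma thetaSq'_nonneg {m n : ℕ} (K : Matrix (Fin m) (Fin n) ℝ)
    (a : Fin m → ℝ) (b : Fin n → ℝ) (u : Fin m → ℝ) (v : Fin n → ℝ) (ha : ∀ i, 0 < a i) :
    0 ≤ thetaSq' K a b u v := by
  refine Real.sSup_nonneg ?_
  rintro _ ⟨w, -, -, rfl⟩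
  rw [dotProduct_Hmat'_mulVec]
  exact div_nonneg (Finset.sum_nonneg fun i _ => div_nonneg (sq_nonneg _) (ha i).le)
    (Finset.sum_nonneg fun j _ => mul_self_nonneg _)

section Coupling

variable {m n : ℕ} {K : Matrix (Fin m) (Fin n) ℝ} {a : Fin m → ℝ} {b : Fin n → ℝ}
  {u : Fin m → ℝ} {v : Fin n → ℝ}

lemma bddAbove_rayleigh_Hmat' (hK : ∀ i j, 0 < K i j) (ha : ∀ i, 0 < a i) (hb : ∀ j, 0 < b j)
    (hu : ∀ i, 0 < u i) (hv : ∀ j, 0 < v j)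
    (hrow : ∀ i, ∑ j, u i * K i j * v j = a i) (hcol : ∀ j, ∑ i, u i * K i j * v j = b j) :
    BddAbove {r : ℝ | ∃ w : Fin n → ℝ, w ≠ 0 ∧ (w ⬝ᵥ fun j => Real.sqrt (b j)) = 0 ∧
      r = w ⬝ᵥ (Hmat' K a b u v).mulVec w / (w ⬝ᵥ w)} := by
  refine ⟨1, ?_⟩
  rintro _ ⟨w, hw, -, rfl⟩
  rw [div_le_one (dotProduct_self_pos hw), dotProduct_Hmat'_mulVec]
  have hP (i : Fin m) (j : Fin n) : 0 ≤ u i * K i j * v j :=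
    (mul_pos (mul_pos (hu i) (hK i j)) (hv j)).le
  calc ∑ i, (∑ j, u i * K i j * v j * (w j / √(b j))) ^ 2 / a i
      ≤ ∑ i, ∑ j, u i * K i j * v j * (w j ^ 2 / b j) := by
        refine Finset.sum_le_sum fun i _ => ?_
        rw [div_le_iff₀ (ha i), ← hrow i]
        refine Finset.sum_sq_le_sum_mul_sum_of_sq_le_mul _
          (fun j _ => mul_nonneg (hP i j) (div_nonneg (sq_nonneg _) (hb j).le))
          (fun j _ => hP i j) fun j _ => le_of_eq ?_
        rw [mul_pow, div_pow, Real.sq_sqrt (hb j).le]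
        ring
    _ = w ⬝ᵥ w := by
        rw [Finset.sum_comm]
        refine Finset.sum_congr rfl fun j _ => ?_
        rw [← Finset.sum_mul, hcol j]
        field_simp [(hb j).ne']

/-- A centred function on the row side provides a lower bound for ϑ². -/
lemma div_le_thetaSq' (hK : ∀ i j, 0 < K i j) (ha : ∀ i, 0 < a i) (hb : ∀ j, 0 < b j)
    (hu : ∀ i, 0 < u i) (hv : ∀ j, 0 < v j)
    (hrow : ∀ i, ∑ j, u i * K i j * v j = a i) (hcol : ∀ j, ∑ i, u i * K i j * v j = b j)
    (s : Fin m → ℝ) (hs : ∑ i, a i * s i = 0)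
    (hN : 0 < ∑ j, (∑ i, u i * K i j * v j * s i) ^ 2 / b j) :
    (∑ j, (∑ i, u i * K i j * v j * s i) ^ 2 / b j) / ∑ i, a i * s i ^ 2 ≤
      thetaSq' K a b u v := by
  set N := ∑ j, (∑ i, u i * K i j * v j * s i) ^ 2 / b j
  set w : Fin n → ℝ := fun j => (∑ i, u i * K i j * v j * s i) / √(b j) with hw
  have hww : w ⬝ᵥ w = N := Finset.sum_congr rfl fun j _ => by
    rw [hw, div_mul_div_comm, Real.mul_self_sqrt (hb j).le, sq]
  have hw0 : w ≠ 0 := fun h => hN.ne' (by rw [← hww, h, dotProduct_zero])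
  have horth : (w ⬝ᵥ fun j => √(b j)) = 0 := by
    calc (w ⬝ᵥ fun j => √(b j)) = ∑ j, ∑ i, u i * K i j * v j * s i :=
          Finset.sum_congr rfl fun j _ => div_mul_cancel₀ _ (Real.sqrt_pos.2 (hb j)).ne'
      _ = 0 := by
          rw [Finset.sum_comm, ← hs]
          exact Finset.sum_congr rfl fun i _ => by rw [← Finset.sum_mul, hrow]
  have hQ := le_csSup (bddAbove_rayleigh_Hmat' hK ha hb hu hv hrow hcol) ⟨w, hw0, horth, rfl⟩
  change _ ≤ thetaSq' K a b u v at hQ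
  refine le_trans ?_ hQ
  rw [hww, dotProduct_Hmat'_mulVec]
  set g : Fin m → ℝ := fun i => ∑ j, u i * K i j * v j * (w j / √(b j)) with hg
  have hpair : ∑ i, s i * g i = N := by
    simp only [hg, Finset.mul_sum]
    rw [Finset.sum_comm, ← hww]
    refine Finset.sum_congr rfl fun j _ => ?_
    calc ∑ i, s i * (u i * K i j * v j * (w j / √(b j)))
        = (∑ i, u i * K i j * v j * s i) * (w j / √(b j)) := by
          rw [Finset.sum_mul]
          exact Finset.sum_congr rfl fun i _ => by ring
      _ = w j * w j := by simp only [hw]; ring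
  have hcs : N ^ 2 ≤ (∑ i, a i * s i ^ 2) * ∑ i, g i ^ 2 / a i := by
    rw [← hpair]
    refine Finset.sum_sq_le_sum_mul_sum_of_sq_le_mul _
      (fun i _ => mul_nonneg (ha i).le (sq_nonneg _))
      (fun i _ => div_nonneg (sq_nonneg _) (ha i).le) fun i _ => le_of_eq ?_
    field_simp [(ha i).ne']
  have hV0 : 0 ≤ ∑ i, a i * s i ^ 2 :=
    Finset.sum_nonneg fun i _ => mul_nonneg (ha i).le (sq_nonneg _)
  have hV : 0 < ∑ i, a i * s i ^ 2 := by
    refine lt_of_le_of_ne hV0 fun h => ?_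
    rw [← h, zero_mul] at hcs
    exact absurd hcs (not_le.2 (pow_pos hN 2))
  rw [div_le_div_iff₀ hV hN, ← sq, mul_comm]
  exact hcs

end Coupling

/-- The chi-square mass of the image of a scaling-weighted function is at least
`(b_min / (‖Kᵀ‖_∞ / σ_min)²) (x i₀)²` when `u` is maximal at `i₀`. -/
lemma le_sum_sq_div {m n : ℕ} (K : Matrix (Fin m) (Fin n) ℝ)
    (hrank : K.rank = m) {b : Fin n → ℝ} (hb : ∀ j, 0 < b j)
    {u : Fin m → ℝ} {v : Fin n → ℝ} (hu : ∀ i, 0 < u i) (hv : ∀ j, 0 < v j)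
    (hcol : ∀ j, v j * (Kᵀ *ᵥ u) j = b j) {i₀ : Fin m} (hi₀ : ∀ i, u i ≤ u i₀)
    (s : Fin m → ℝ) :
    (⨅ j, b j) / (normInfRow Kᵀ / sigmaMin K) ^ 2 * s i₀ ^ 2 ≤
      ∑ j, (∑ i, u i * K i j * v j * s i) ^ 2 / b j := by
  set κ := normInfRow Kᵀ with hκ
  set x : Fin m → ℝ := fun i => u i * s i with hx
  have hbmin (j : Fin n) : (⨅ j, b j) ≤ b j := ciInf_le (Set.finite_range b).bddBelow j
  have hbmin0 : 0 ≤ ⨅ j, b j := Real.iInf_nonneg fun j => (hb j).le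
  have hS (j : Fin n) : 0 < (Kᵀ *ᵥ u) j := pos_of_mul_pos_right (hcol j ▸ hb j) (hv j).le
  have hSle (j : Fin n) : (Kᵀ *ᵥ u) j ≤ κ * u i₀ := by
    calc (Kᵀ *ᵥ u) j ≤ (∑ i, |Kᵀ j i|) * u i₀ := by
          rw [mulVec, dotProduct, Finset.sum_mul]
          refine Finset.sum_le_sum fun i _ => ?_
          exact mul_le_mul (le_abs_self (Kᵀ j i)) (hi₀ i) (hu i).le (abs_nonneg _)
      _ ≤ κ * u i₀ := by
          refine mul_le_mul_of_nonneg_right ?_ (hu i₀).le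
          exact le_ciSup (f := fun j => ∑ i, |Kᵀ j i|) (Set.finite_range _).bddAbove j
  have hz (j : Fin n) : (∑ i, u i * K i j * v j * s i) = v j * (Kᵀ *ᵥ x) j := by
    simp only [mulVec, dotProduct, transpose_apply, hx, Finset.mul_sum]
    exact Finset.sum_congr rfl fun i _ => by ring
  have hterm (j : Fin n) : (⨅ j, b j) / (κ * u i₀) ^ 2 * ((Kᵀ *ᵥ x) j * (Kᵀ *ᵥ x) j) ≤
      (∑ i, u i * K i j * v j * s i) ^ 2 / b j := by
    have h : (v j * (Kᵀ *ᵥ x) j) ^ 2 / b j =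
        b j / (Kᵀ *ᵥ u) j ^ 2 * ((Kᵀ *ᵥ x) j * (Kᵀ *ᵥ x) j) := by
      have := (hS j).ne'
      have := (hv j).ne'
      rw [← hcol j]
      field_simp
    rw [hz, h]
    refine mul_le_mul_of_nonneg_right ?_ (mul_self_nonneg _)
    exact div_le_div₀ (hb j).le (hbmin j) (pow_pos (hS j) 2)
      (pow_le_pow_left₀ (hS j).le (hSle j) 2)
  have hxx : u i₀ ^ 2 * s i₀ ^ 2 ≤ x ⬝ᵥ x := by
    calc u i₀ ^ 2 * s i₀ ^ 2 = x i₀ * x i₀ := by simp only [hx]; ring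
      _ ≤ x ⬝ᵥ x := Finset.single_le_sum (f := fun i => x i * x i)
          (fun i _ => mul_self_nonneg (x i)) (Finset.mem_univ i₀)
  have hu0 := (hu i₀).ne'
  calc (⨅ j, b j) / (κ / sigmaMin K) ^ 2 * s i₀ ^ 2
      = (⨅ j, b j) / (κ * u i₀) ^ 2 * (sigmaMin K ^ 2 * (u i₀ ^ 2 * s i₀ ^ 2)) := by
        rw [div_pow, mul_pow, div_div_eq_mul_div]
        field_simp
    _ ≤ (⨅ j, b j) / (κ * u i₀) ^ 2 * ((Kᵀ *ᵥ x) ⬝ᵥ (Kᵀ *ᵥ x)) := by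
        refine mul_le_mul_of_nonneg_left ?_ (div_nonneg hbmin0 (sq_nonneg _))
        exact (mul_le_mul_of_nonneg_left hxx (sq_nonneg _)).trans (sigmaMin_sq_mul_le K hrank x)
    _ ≤ ∑ j, (∑ i, u i * K i j * v j * s i) ^ 2 / b j := by
        rw [dotProduct, Finset.mul_sum]
        exact Finset.sum_le_sum fun j _ => hterm j

theorem thetaSq_lower_bound_delta_two
    {m n : ℕ} (hm : 2 ≤ m) (hmn : m ≤ n)
    (K : Matrix (Fin m) (Fin n) ℝ) (hK : ∀ i j, 0 < K i j) (hrank : K.rank = m)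
    (a : Fin m → ℝ) (b : Fin n → ℝ) (ha : ∀ i, 0 < a i) (hb : ∀ j, 0 < b j)
    (hsuma : ∑ i, a i = 1) (hsumb : ∑ j, b j = 1)
    (ustar : Fin m → ℝ) (vstar : Fin n → ℝ)
    (hustar : ∀ i, 0 < ustar i) (hvstar : ∀ j, 0 < vstar j)
    (hsol1 : ∀ i, ustar i * K.mulVec vstar i = a i)
    (hsol2 : ∀ j, vstar j * Kᵀ.mulVec ustar j = b j) :
    (⨅ j, b j) / (⨆ i, a i) * (1 - ⨆ i, a i) /
        ((normInfRow Kᵀ / sigmaMin K) ^ 2 - ⨅ j, b j) ≤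
      thetaSq' K a b ustar vstar := by
  set β := ⨅ j, b j with hβ
  set A := ⨆ i, a i with hA
  set q := (normInfRow Kᵀ / sigmaMin K) ^ 2 with hq
  have : Nonempty (Fin m) := ⟨⟨0, by omega⟩⟩
  have : Nonempty (Fin n) := ⟨⟨0, by omega⟩⟩
  have hrow (i : Fin m) : ∑ j, ustar i * K i j * vstar j = a i := by
    rw [← hsol1 i, mulVec, dotProduct, Finset.mul_sum]
    exact Finset.sum_congr rfl fun j _ => by ring
  have hcol (j : Fin n) : ∑ i, ustar i * K i j * vstar j = b j := by
    rw [← hsol2 j, mulVec, dotProduct, Finset.mul_sum]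
    exact Finset.sum_congr rfl fun i _ => by rw [transpose_apply]; ring
  have hβ0 : 0 < β := by
    obtain ⟨j, hj⟩ := exists_eq_ciInf_of_finite (f := b)
    rw [hβ, ← hj]
    exact hb j
  have haA (i : Fin m) : a i ≤ A := le_ciSup (Set.finite_range a).bddAbove i
  have ha1 (i : Fin m) : a i < 1 := by
    obtain ⟨k, hk⟩ : ∃ k : Fin m, k ≠ i :=
      have := Fin.nontrivial_iff_two_le.2 hm
      exists_ne i
    have h := Finset.add_le_sum (f := a) (fun i _ => (ha i).le) (Finset.mem_univ i)
      (Finset.mem_univ k) hk.symm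
    linarith [ha k]
  have hA1 : A < 1 := by
    obtain ⟨i, hi⟩ := exists_eq_ciSup_of_finite (f := a)
    rw [hA, ← hi]
    exact ha1 i
  have hA0 : 0 < A := (ha (Classical.arbitrary _)).trans_le (haA _)
  rcases le_or_gt (q - β) 0 with hneg | hpos
  · refine le_trans ?_ (thetaSq'_nonneg K a b ustar vstar ha)
    exact div_nonpos_of_nonneg_of_nonpos
      (mul_nonneg (div_nonneg hβ0.le hA0.le) (sub_nonneg.2 hA1.le)) hneg
  have hq0 : 0 < q := by linarith
  set c := β / q with hc
  have hc0 : 0 < c := div_pos hβ0 hq0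
  have hc1 : c < 1 := (div_lt_one hq0).2 (by linarith)
  obtain ⟨i₀, hi₀⟩ := Finite.exists_max ustar
  have hai := ha i₀
  have hai1 := ha1 i₀
  -- `s` equals `1` at `i₀`, is constant elsewhere, and has `a`-mean `c`.
  set d := (c - a i₀) / (1 - a i₀) with hd
  set s : Fin m → ℝ := fun i => if i = i₀ then 1 else d with hs
  have hs0 : s i₀ = 1 := if_pos rfl
  have hsum (f : ℝ → ℝ) : ∑ i, a i * f (s i) = a i₀ * f 1 + (1 - a i₀) * f d := by
    have h (i : Fin m) : a i * f (s i) = a i * f d + if i = i₀ then a i * (f 1 - f d) else 0 := by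
      by_cases hi : i = i₀ <;> simp [hs, hi]
      ring
    rw [Finset.sum_congr rfl fun i _ => h i, Finset.sum_add_distrib, ← Finset.sum_mul, hsuma,
      Finset.sum_ite_eq' Finset.univ i₀, if_pos (Finset.mem_univ _)]
    ring
  have hdmul : (1 - a i₀) * d = c - a i₀ := mul_div_cancel₀ _ (by linarith)
  have hmean : ∑ i, a i * s i = c := by
    have h := hsum id
    simp only [id] at h
    linarith
  have hcent : ∑ i, a i * (s i - c) = 0 := by
    simp only [mul_sub, Finset.sum_sub_distrib, ← Finset.sum_mul, hsuma, hmean]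
    ring
  have hvar : ∑ i, a i * (s i - c) ^ 2 = a i₀ * (1 - c) ^ 2 / (1 - a i₀) := by
    have : 1 - a i₀ ≠ 0 := by linarith
    rw [hsum fun x => (x - c) ^ 2, hd]
    field_simp
    ring
  have hmass : ∑ j, ∑ i, ustar i * K i j * vstar j * s i = c := by
    rw [Finset.sum_comm, ← hmean]
    exact Finset.sum_congr rfl fun i _ => by rw [← Finset.sum_mul, hrow]
  have hN : ∑ j, (∑ i, ustar i * K i j * vstar j * (s i - c)) ^ 2 / b j =
      ∑ j, (∑ i, ustar i * K i j * vstar j * s i) ^ 2 / b j - c ^ 2 := by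
    have h (j : Fin n) : (∑ i, ustar i * K i j * vstar j * (s i - c)) ^ 2 / b j =
        (∑ i, ustar i * K i j * vstar j * s i) ^ 2 / b j
          - 2 * c * (∑ i, ustar i * K i j * vstar j * s i) + c ^ 2 * b j := by
      simp only [mul_sub, Finset.sum_sub_distrib, ← Finset.sum_mul _ _ c, hcol]
      generalize ∑ i, ustar i * K i j * vstar j * s i = p
      have := (hb j).ne'
      field_simp
      ring
    rw [Finset.sum_congr rfl fun j _ => h j, Finset.sum_add_distrib, Finset.sum_sub_distrib,
      ← Finset.mul_sum, ← Finset.mul_sum, hmass, hsumb]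
    ring
  have hlow := le_sum_sq_div K hrank hb hustar hvstar hsol2 hi₀ s
  rw [hs0, one_pow, mul_one] at hlow
  have hNlow : c * (1 - c) ≤ ∑ j, (∑ i, ustar i * K i j * vstar j * (s i - c)) ^ 2 / b j := by
    rw [hN]
    linarith
  have hcc : 0 < c * (1 - c) := mul_pos hc0 (by linarith)
  refine le_trans ?_ (div_le_thetaSq' hK ha hb hustar hvstar hrow hcol (fun i => s i - c) hcent
    (hcc.trans_le hNlow))
  rw [hvar]
  have hV : 0 < a i₀ * (1 - c) ^ 2 / (1 - a i₀) :=
    div_pos (mul_pos hai (pow_pos (by linarith) 2)) (by linarith)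
  refine le_trans ?_ (div_le_div_of_nonneg_right hNlow hV.le)
  have hright : c * (1 - c) / (a i₀ * (1 - c) ^ 2 / (1 - a i₀)) =
      c / (1 - c) * ((1 - a i₀) / a i₀) := by
    have : 1 - a i₀ ≠ 0 := by linarith
    have : 1 - c ≠ 0 := by linarith
    field_simp
  have hleft : β / A * (1 - A) / (q - β) = c / (1 - c) * ((1 - A) / A) := by
    have h1 : 1 - c = (q - β) / q := by rw [hc]; field_simp
    rw [h1, hc]
    field_simp
  rw [hright, hleft]
  refine mul_le_mul_of_nonneg_left ?_ (div_nonneg hc0.le (by linarith))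
  exact div_le_div₀ (by linarith) (by linarith [haA i₀]) hai (haA i₀)
end

section
/- Let K be an entrywise positive m×n real matrix, let a ∈ ℝ^m, b ∈ ℝ^n be entrywise positive vectors, let (u*, v*) be a solution of the scaling problem, and assume 0 < ϑ² < 1. Then for every 0 < ω < 2 the overrelaxed Sinkhorn iteration is locally convergent to (u*, v*) with asymptotic rate at most ρ_ϑ(ω): for every ε > 0 with ρ_ϑ(ω) + ε < 1 there exist δ > 0 and C > 0 such that whenever d_H(u_0, u*) ≤ δ and d_H(v_0, v*) ≤ δ, the iterates satisfy d_H(u_ℓ, u*) + d_H(v_ℓ, v*) ≤ C (ρ_ϑ(ω) + ε)^ℓ for all ℓ. -/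
open Matrix

/-- Hilbert projective distance between entrywise positive vectors. -/
noncomputable def dH {m : ℕ} (x y : Fin m → ℝ) : ℝ :=
  Real.log (⨆ i, ⨆ j, x i * y j / (x j * y i))

/-- The asymptotic convergence rate ρ_ϑ(ω) of the overrelaxed Sinkhorn method. -/
noncomputable def sinkhornRate (θ ω : ℝ) : ℝ :=
  if ω ≤ 2 / (1 + Real.sqrt (1 - θ ^ 2)) then
    1 / 4 * (ω * θ + Real.sqrt (ω ^ 2 * θ ^ 2 - 4 * (ω - 1))) ^ 2
  else ω - 1

/-- The matrix H = diag(u*/√a) K diag(v*∘v*/b) Kᵀ diag(u*/√a). -/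
noncomputable def Hmat {m n : ℕ} (K : Matrix (Fin m) (Fin n) ℝ)
    (a : Fin m → ℝ) (b : Fin n → ℝ) (u : Fin m → ℝ) (v : Fin n → ℝ) :
    Matrix (Fin m) (Fin m) ℝ :=
  Matrix.diagonal (fun i => u i / Real.sqrt (a i)) * K *
    Matrix.diagonal (fun j => v j * v j / b j) * Kᵀ *
    Matrix.diagonal (fun i => u i / Real.sqrt (a i))

/-- ϑ² = sup of the Rayleigh quotient of H over the orthogonal complement of √a. -/
noncomputable def thetaSq {m n : ℕ} (K : Matrix (Fin m) (Fin n) ℝ)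
    (a : Fin m → ℝ) (b : Fin n → ℝ) (u : Fin m → ℝ) (v : Fin n → ℝ) : ℝ :=
  sSup {r : ℝ | ∃ w : Fin m → ℝ, w ≠ 0 ∧ (w ⬝ᵥ fun i => Real.sqrt (a i)) = 0 ∧
    r = w ⬝ᵥ (Hmat K a b u v).mulVec w / (w ⬝ᵥ w)}

section OverrelaxedSinkhorn

variable {ι κ : Type*} [Fintype ι] [Fintype κ]

/-- The squared weighted Euclidean norm. -/
def weightedSq (a : ι → ℝ) (x : ι → ℝ) : ℝ := ∑ i, a i * x i ^ 2

/-- The bilinear form of a coupling. -/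
def couplingForm (M : ι → κ → ℝ) (x : ι → ℝ) (y : κ → ℝ) : ℝ := ∑ i, x i * ∑ j, M i j * y j

/-- The quadratic Lyapunov function of an overrelaxed half step with shift `q = ω - 1`. -/
def lyapunov (r q ω : ℝ) (a : ι → ℝ) (b : κ → ℝ) (M : ι → κ → ℝ) (x : ι → ℝ) (y : κ → ℝ) : ℝ :=
  (r + q) * (r * weightedSq a x + weightedSq b y) + 2 * ω * r * couplingForm M x y

/-- Subtraction of the weighted mean. -/
noncomputable def center (a : ι → ℝ) (x : ι → ℝ) : ι → ℝ :=
  fun i => x i - (∑ k, a k * x k) / ∑ k, a k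

/-- An overrelaxed half step in logarithmic coordinates. -/
noncomputable def logStep (q ω : ℝ) (a : ι → ℝ) (M : ι → κ → ℝ) (x : ι → ℝ) (y : κ → ℝ) : ι → ℝ :=
  fun i => -q * x i - ω * Real.log (∑ j, M i j / a i * Real.exp (y j))

/-- `M` is a nonnegative matrix with positive marginals `a` and `b`. -/
structure IsCoupling (a : ι → ℝ) (b : κ → ℝ) (M : ι → κ → ℝ) : Prop where
  left_pos : ∀ i, 0 < a i
  right_pos : ∀ j, 0 < b j
  nonneg : ∀ i j, 0 ≤ M i j
  row : ∀ i, ∑ j, M i j = a i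
  col : ∀ j, ∑ i, M i j = b j

/-- The maximal correlation of the coupling `M` is at most `θ`. -/
def CorrelationLE (θ : ℝ) (a : ι → ℝ) (b : κ → ℝ) (M : ι → κ → ℝ) : Prop :=
  ∀ x y, ∑ i, a i * x i = 0 → ∑ j, b j * y j = 0 →
    couplingForm M x y ^ 2 ≤ θ ^ 2 * (weightedSq a x * weightedSq b y)

theorem couplingForm_swap (M : ι → κ → ℝ) (x : ι → ℝ) (y : κ → ℝ) :
    couplingForm (fun j i => M i j) y x = couplingForm M x y := by
  simp only [couplingForm, Finset.mul_sum]
  rw [Finset.sum_comm]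
  exact Finset.sum_congr rfl fun i _ => Finset.sum_congr rfl fun j _ => by ring

theorem IsCoupling.symm {a : ι → ℝ} {b : κ → ℝ} {M : ι → κ → ℝ} (hM : IsCoupling a b M) :
    IsCoupling b a (fun j i => M i j) :=
  ⟨hM.right_pos, hM.left_pos, fun j i => hM.nonneg i j, hM.col, hM.row⟩

theorem CorrelationLE.symm {θ : ℝ} {a : ι → ℝ} {b : κ → ℝ} {M : ι → κ → ℝ}
    (h : CorrelationLE θ a b M) : CorrelationLE θ b a (fun j i => M i j) := by
  intro y x hy hx
  rw [couplingForm_swap, mul_comm (weightedSq b y)]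
  exact h x y hx hy

theorem IsCoupling.le_right {a : ι → ℝ} {b : κ → ℝ} {M : ι → κ → ℝ} (hM : IsCoupling a b M)
    (i : ι) (j : κ) : M i j ≤ b j := by
  rw [← hM.col j]
  exact Finset.single_le_sum (f := fun i => M i j) (fun k _ => hM.nonneg k j) (Finset.mem_univ i)

theorem weightedSq_nonneg {a : ι → ℝ} (ha : ∀ i, 0 < a i) (x : ι → ℝ) : 0 ≤ weightedSq a x :=
  Finset.sum_nonneg fun i _ => mul_nonneg (ha i).le (sq_nonneg _)

theorem le_weightedSq {a : ι → ℝ} (ha : ∀ i, 0 < a i) (x : ι → ℝ) (i : ι) :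
    a i * x i ^ 2 ≤ weightedSq a x :=
  Finset.single_le_sum (f := fun i => a i * x i ^ 2)
    (fun i _ => mul_nonneg (ha i).le (sq_nonneg _)) (Finset.mem_univ i)

theorem weightedSq_add_smul (a : ι → ℝ) (s t : ℝ) (x y : ι → ℝ) :
    weightedSq a (fun i => s * x i + t * y i) =
      s ^ 2 * weightedSq a x + 2 * s * t * (∑ i, a i * x i * y i) + t ^ 2 * weightedSq a y := by
  simp only [weightedSq, Finset.mul_sum, ← Finset.sum_add_distrib]
  exact Finset.sum_congr rfl fun i _ => by ring

theorem couplingForm_add_smul (M : ι → κ → ℝ) (s t : ℝ) (x z : ι → ℝ) (y : κ → ℝ) :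
    couplingForm M (fun i => s * x i + t * z i) y =
      s * couplingForm M x y + t * couplingForm M z y := by
  simp only [couplingForm, Finset.mul_sum (s := Finset.univ) (f := fun i => _ * ∑ j, _),
    ← Finset.sum_add_distrib]
  exact Finset.sum_congr rfl fun i _ => by ring

theorem weightedSq_smul (a : ι → ℝ) (s : ℝ) (x : ι → ℝ) :
    weightedSq a (fun i => s * x i) = s ^ 2 * weightedSq a x := by
  simp only [weightedSq, Finset.mul_sum]
  exact Finset.sum_congr rfl fun i _ => by ring

theorem couplingForm_eq_sum {a : ι → ℝ} {b : κ → ℝ} {M : ι → κ → ℝ} (hM : IsCoupling a b M)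
    (x : ι → ℝ) (y : κ → ℝ) :
    couplingForm M x y = ∑ i, a i * x i * (∑ j, M i j / a i * y j) := by
  refine Finset.sum_congr rfl fun i _ => ?_
  rw [Finset.mul_sum, Finset.mul_sum]
  refine Finset.sum_congr rfl fun j _ => ?_
  have := (hM.left_pos i).ne'
  field_simp

theorem lyapunov_linear_step_le {r q ω : ℝ} {a : ι → ℝ} {b : κ → ℝ} {M : ι → κ → ℝ}
    (hM : IsCoupling a b M) (hq : q ≤ r) (x : ι → ℝ) (y : κ → ℝ) :
    lyapunov r q ω b a (fun j i => M i j) y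
      (fun i => -q * x i + -ω * ∑ j, M i j / a i * y j) ≤ r * lyapunov r q ω a b M x y := by
  have hw : weightedSq a (fun i => (r + q) * x i + ω * ∑ j, M i j / a i * y j) ≥ 0 :=
    weightedSq_nonneg hM.left_pos _
  simp only [lyapunov, couplingForm_swap]
  rw [couplingForm_add_smul, couplingForm_eq_sum hM (fun i => ∑ j, M i j / a i * y j),
    couplingForm_eq_sum hM x]
  rw [weightedSq_add_smul] at hw ⊢
  have e : ∑ i, a i * (∑ j, M i j / a i * y j) * (∑ j, M i j / a i * y j) =
      weightedSq a (fun i => ∑ j, M i j / a i * y j) :=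
    Finset.sum_congr rfl fun i _ => by ring
  rw [e]
  nlinarith [mul_nonneg (sub_nonneg.2 hq) hw]

theorem CorrelationLE.two_mul_abs_le {θ r : ℝ} {a : ι → ℝ} {b : κ → ℝ} {M : ι → κ → ℝ}
    (hM : IsCoupling a b M) (h : CorrelationLE θ a b M) (hθ : 0 ≤ θ) (hr : 0 < r)
    {x : ι → ℝ} {y : κ → ℝ} (hx : ∑ i, a i * x i = 0) (hy : ∑ j, b j * y j = 0) :
    2 * √r * |couplingForm M x y| ≤ θ * (r * weightedSq a x + weightedSq b y) := by
  have hX := weightedSq_nonneg hM.left_pos x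
  have hY := weightedSq_nonneg hM.right_pos y
  refine abs_le_of_sq_le_sq' ?_ (by positivity) |>.2
  have hs := Real.sq_sqrt hr.le
  calc (2 * √r * |couplingForm M x y|) ^ 2 = 4 * r * couplingForm M x y ^ 2 := by
        rw [mul_pow, mul_pow, hs, sq_abs]; ring
    _ ≤ 4 * r * (θ ^ 2 * (weightedSq a x * weightedSq b y)) := by
        gcongr
        exact h x y hx hy
    _ ≤ _ := by nlinarith [mul_nonneg (sq_nonneg θ) (sq_nonneg (r * weightedSq a x - weightedSq b y))]

theorem lyapunov_bounds {θ r q ω : ℝ} {a : ι → ℝ} {b : κ → ℝ} {M : ι → κ → ℝ}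
    (hM : IsCoupling a b M) (h : CorrelationLE θ a b M) (hθ : 0 ≤ θ) (hr : 0 < r) (hω : 0 < ω)
    {x : ι → ℝ} {y : κ → ℝ} (hx : ∑ i, a i * x i = 0) (hy : ∑ j, b j * y j = 0) :
    (r + q - ω * θ * √r) * (r * weightedSq a x + weightedSq b y) ≤ lyapunov r q ω a b M x y ∧
    lyapunov r q ω a b M x y ≤ (r + q + ω * θ * √r) * (r * weightedSq a x + weightedSq b y) := by
  have key := h.two_mul_abs_le hM hθ hr hx hy
  have hs := Real.mul_self_sqrt hr.le
  have hs0 := Real.sqrt_nonneg r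
  have h2 : |2 * ω * r * couplingForm M x y| ≤
      ω * θ * √r * (r * weightedSq a x + weightedSq b y) := by
    have e : |2 * ω * r * couplingForm M x y| = ω * √r * (2 * √r * |couplingForm M x y|) := by
      rw [abs_mul, abs_of_pos (by positivity)]
      linear_combination -2 * ω * |couplingForm M x y| * hs
    rw [e]
    calc _ ≤ ω * √r * (θ * (r * weightedSq a x + weightedSq b y)) := by gcongr
      _ = _ := by ring
  have h3 := abs_le.1 h2
  simp only [lyapunov]
  constructor <;> nlinarith [h3.1, h3.2]

theorem sum_mul_center {a : ι → ℝ} (ha : ∀ i, 0 < a i) (x : ι → ℝ) :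
    ∑ i, a i * center a x i = 0 := by
  rcases isEmpty_or_nonempty ι with hι | hι
  · simp
  · have hs : 0 < ∑ i, a i := Finset.sum_pos (fun i _ => ha i) Finset.univ_nonempty
    simp only [center, mul_sub, Finset.sum_sub_distrib, ← Finset.sum_mul]
    field_simp
    ring

theorem center_eq_of_sub_const {a : ι → ℝ} (ha : ∀ i, 0 < a i) {x y : ι → ℝ} (c : ℝ)
    (h : ∀ i, x i = y i + c) : center a x = center a y := by
  funext i
  have hs : 0 < ∑ i, a i := Finset.sum_pos (fun i _ => ha i) ⟨i, Finset.mem_univ i⟩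
  simp only [center, h, mul_add, Finset.sum_add_distrib, ← Finset.sum_mul]
  field_simp
  ring

theorem center_of_sum_eq_zero {a : ι → ℝ} {x : ι → ℝ} (h : ∑ i, a i * x i = 0) :
    center a x = x := by
  funext i
  simp [center, h]

theorem center_add (a : ι → ℝ) (x y : ι → ℝ) :
    center a (fun i => x i + y i) = fun i => center a x i + center a y i := by
  funext i
  simp only [center, mul_add, Finset.sum_add_distrib]
  ring

theorem weightedSq_center_le {a : ι → ℝ} (ha : ∀ i, 0 < a i) (x : ι → ℝ) :
    weightedSq a (center a x) ≤ weightedSq a x := by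
  have h0 := sum_mul_center ha x
  have hs : 0 ≤ ∑ i, a i := Finset.sum_nonneg fun i _ => (ha i).le
  have : weightedSq a x = weightedSq a (center a x) +
      (2 * ((∑ k, a k * x k) / ∑ k, a k) * ∑ i, a i * center a x i +
        ((∑ k, a k * x k) / ∑ k, a k) ^ 2 * ∑ i, a i) := by
    simp only [weightedSq, Finset.mul_sum, ← Finset.sum_add_distrib]
    exact Finset.sum_congr rfl fun i _ => by simp only [center]; ring
  rw [this, h0]
  have := mul_nonneg (sq_nonneg ((∑ k, a k * x k) / ∑ k, a k)) hs
  linarith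

theorem center_logStep_center {q ω : ℝ} {a : ι → ℝ} {b : κ → ℝ} {M : ι → κ → ℝ}
    (hM : IsCoupling a b M) [Nonempty κ] (hpos : ∀ i j, 0 < M i j) (x : ι → ℝ) (y : κ → ℝ) :
    center a (logStep q ω a M (center a x) (center b y)) = center a (logStep q ω a M x y) := by
  refine center_eq_of_sub_const hM.left_pos
    (q * ((∑ k, a k * x k) / ∑ k, a k) + ω * ((∑ k, b k * y k) / ∑ k, b k)) fun i => ?_
  have hS : 0 < ∑ j, M i j / a i * Real.exp (y j) :=
    Finset.sum_pos (fun j _ => mul_pos (div_pos (hpos i j) (hM.left_pos i)) (Real.exp_pos _))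
      Finset.univ_nonempty
  simp only [logStep, center, sub_eq_add_neg (y _), Real.exp_add, ← mul_assoc, ← Finset.sum_mul]
  rw [Real.log_mul hS.ne' (Real.exp_pos _).ne', Real.log_exp]
  ring

theorem exp_sub_one_le_add_sq {t : ℝ} (ht : |t| ≤ 1) : Real.exp t - 1 ≤ t + t ^ 2 := by
  have := (abs_le.1 (Real.abs_exp_sub_one_sub_id_le ht)).2
  linarith

theorem log_sum_exp_bounds {a : ι → ℝ} {b : κ → ℝ} {M : ι → κ → ℝ}
    (hM : IsCoupling a b M) (hpos : ∀ i j, 0 < M i j) [Nonempty κ] {y : κ → ℝ}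
    (hy : ∀ j, |y j| ≤ 1) (i : ι) :
    0 ≤ Real.log (∑ j, M i j / a i * Real.exp (y j)) - ∑ j, M i j / a i * y j ∧
    Real.log (∑ j, M i j / a i * Real.exp (y j)) - ∑ j, M i j / a i * y j ≤
      weightedSq b y / a i := by
  have hai := hM.left_pos i
  have hS : 0 < ∑ j, M i j / a i * Real.exp (y j) :=
    Finset.sum_pos (fun j _ => mul_pos (div_pos (hpos i j) hai) (Real.exp_pos _))
      Finset.univ_nonempty
  have h1 : ∑ j, M i j / a i = 1 := by
    rw [← Finset.sum_div, hM.row, div_self hai.ne']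
  constructor
  · rw [sub_nonneg, Real.le_log_iff_exp_le hS]
    have := convexOn_exp.map_sum_le (t := Finset.univ) (w := fun j => M i j / a i) (p := y)
      (fun j _ => (div_pos (hpos i j) hai).le) h1 (fun _ _ => Set.mem_univ _)
    simpa only [smul_eq_mul] using this
  · have h2 := Real.log_le_sub_one_of_pos hS
    have h3 : ∑ j, M i j / a i * Real.exp (y j) - 1 ≤
        ∑ j, M i j / a i * y j + ∑ j, M i j / a i * y j ^ 2 := by
      rw [← h1, ← Finset.sum_sub_distrib, ← Finset.sum_add_distrib]
      refine Finset.sum_le_sum fun j _ => ?_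
      have := mul_le_mul_of_nonneg_left (exp_sub_one_le_add_sq (hy j))
        (div_pos (hpos i j) hai).le
      linarith
    have h4 : ∑ j, M i j / a i * y j ^ 2 ≤ weightedSq b y / a i := by
      rw [weightedSq, Finset.sum_div]
      refine Finset.sum_le_sum fun j _ => ?_
      rw [div_mul_eq_mul_div]
      gcongr
      exact hM.le_right i j
    linarith

theorem lyapunov_add_right_le {θ r q ω τ : ℝ} {a : ι → ℝ} {b : κ → ℝ} {M : ι → κ → ℝ}
    (hM : IsCoupling a b M) (h : CorrelationLE θ a b M) (hθ : 0 ≤ θ) (hr : 0 < r) (hω : 0 < ω)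
    (hc : ω * θ * √r < r + q) (hτ : 0 < τ) {x : ι → ℝ} {y e : κ → ℝ}
    (hx : ∑ i, a i * x i = 0) (hy : ∑ j, b j * y j = 0) (he : ∑ j, b j * e j = 0) :
    lyapunov r q ω a b M x (fun j => y j + e j) ≤
      (1 + τ) * lyapunov r q ω a b M x y + (1 + 1 / τ) * ((r + q) * weightedSq b e) := by
  have hx' : ∑ i, a i * (τ * x i) = 0 := by
    have : ∑ i, a i * (τ * x i) = τ * ∑ i, a i * x i := by
      rw [Finset.mul_sum]; exact Finset.sum_congr rfl fun i _ => by ring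
    rw [this, hx, mul_zero]
  have hy' : ∑ j, b j * (τ * y j + -1 * e j) = 0 := by
    have : ∑ j, b j * (τ * y j + -1 * e j) = τ * ∑ j, b j * y j - ∑ j, b j * e j := by
      rw [Finset.mul_sum, ← Finset.sum_sub_distrib]
      exact Finset.sum_congr rfl fun i _ => by ring
    rw [this, hy, he]; simp
  have key := (lyapunov_bounds (q := q) hM h hθ hr hω hx' hy').1
  have h0 : 0 ≤ lyapunov r q ω a b M (fun i => τ * x i) (fun j => τ * y j + -1 * e j) :=
    le_trans (mul_nonneg (sub_nonneg.2 hc.le) (add_nonneg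
      (mul_nonneg hr.le (weightedSq_nonneg hM.left_pos _)) (weightedSq_nonneg hM.right_pos _))) key
  have e1 := couplingForm_add_smul (fun j i => M i j) 1 1 y e x
  have e2 := couplingForm_add_smul (fun j i => M i j) τ (-1) y e (fun i => τ * x i)
  have e3 := weightedSq_add_smul b 1 1 y e
  simp only [one_mul, couplingForm_swap] at e1 e2 e3
  have e4 (z : κ → ℝ) : couplingForm M (fun i => τ * x i) z = τ * couplingForm M x z := by
    simpa using couplingForm_add_smul M τ 0 x x z
  simp only [lyapunov] at h0 ⊢
  rw [e2, weightedSq_add_smul, weightedSq_smul, e4, e4] at h0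
  rw [e1, e3]
  have h5 := div_nonneg h0 hτ.le
  field_simp at h5 ⊢
  nlinarith [h5]

theorem exists_lyapunov_logStep_le {θ r R q ω : ℝ} {a : ι → ℝ} {b : κ → ℝ} {M : ι → κ → ℝ}
    [Nonempty κ] (hM : IsCoupling a b M) (hpos : ∀ i j, 0 < M i j) (h : CorrelationLE θ a b M)
    (hθ : 0 ≤ θ) (hr : 0 < r) (hω : 0 < ω) (hq : q ≤ r) (hc : ω * θ * √r < r + q) (hR : r < R) :
    ∃ v₀ > 0, ∀ x y, ∑ i, a i * x i = 0 → ∑ j, b j * y j = 0 →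
      lyapunov r q ω a b M x y ≤ v₀ →
      lyapunov r q ω b a (fun j i => M i j) y (center a (logStep q ω a M x y)) ≤
        R * lyapunov r q ω a b M x y := by
  obtain ⟨β, hβ, hβb⟩ : ∃ β > 0, ∀ j, β ≤ b j := by
    obtain ⟨j₀, hj₀⟩ := Finite.exists_min b
    exact ⟨b j₀, hM.right_pos j₀, hj₀⟩
  set c := r + q - ω * θ * √r with hcdef
  have hc0 : 0 < c := sub_pos.2 hc
  have hrq : 0 < r + q := lt_of_le_of_lt (by positivity) hc
  set τ := (R - r) / (2 * r) with hτdef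
  have hτ : 0 < τ := div_pos (sub_pos.2 hR) (by positivity)
  have hA : 0 ≤ ∑ i, 1 / a i := Finset.sum_nonneg fun i _ => (one_div_pos.2 (hM.left_pos i)).le
  set G := (1 + 1 / τ) * ((r + q) * (ω ^ 2 * ((∑ i, 1 / a i) / c ^ 2))) with hG
  have hG0 : 0 ≤ G := by positivity
  refine ⟨min (c * β) ((R - r) / (2 * (G + 1))), lt_min (by positivity)
    (div_pos (sub_pos.2 hR) (by positivity)), fun x y hx hy hv => ?_⟩
  set V := lyapunov r q ω a b M x y with hV
  have hX := weightedSq_nonneg hM.left_pos x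
  have hY := weightedSq_nonneg hM.right_pos y
  have hlow := (lyapunov_bounds (q := q) hM h hθ hr hω hx hy).1
  rw [← hcdef, ← hV] at hlow
  have hyV : c * weightedSq b y ≤ V := by nlinarith [mul_nonneg hc0.le (mul_nonneg hr.le hX)]
  have hV0 : 0 ≤ V := le_trans (by positivity) hyV
  have hy1 : ∀ j, |y j| ≤ 1 := by
    intro j
    rw [← sq_le_one_iff_abs_le_one]
    have h1 := le_weightedSq hM.right_pos y j
    have h2 : c * weightedSq b y ≤ c * β := hyV.trans (hv.trans (min_le_left _ _))
    have h3 := le_of_mul_le_mul_left h2 hc0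
    have h4 : b j * y j ^ 2 ≤ b j * 1 := by linarith [hβb j]
    exact le_of_mul_le_mul_left h4 (hM.right_pos j)
  set L : ι → ℝ := fun i => -q * x i + -ω * ∑ j, M i j / a i * y j with hL
  set E : ι → ℝ := fun i => -ω * (Real.log (∑ j, M i j / a i * Real.exp (y j)) -
    ∑ j, M i j / a i * y j) with hE
  have hstep : logStep q ω a M x y = fun i => L i + E i := by
    funext i; simp only [logStep, hL, hE]; ring
  have hLsum : ∑ i, a i * L i = 0 := by
    have e1 : ∑ i, a i * L i = -q * ∑ i, a i * x i + -ω * ∑ i, ∑ j, M i j * y j := by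
      simp only [hL, Finset.mul_sum, ← Finset.sum_add_distrib]
      refine Finset.sum_congr rfl fun i _ => ?_
      have := (hM.left_pos i).ne'
      rw [mul_add, Finset.mul_sum]
      congr 1
      · ring
      · exact Finset.sum_congr rfl fun j _ => by field_simp
    rw [e1, hx, Finset.sum_comm]
    simp only [← Finset.sum_mul, hM.col, hy]
    simp
  have hcen : center a (logStep q ω a M x y) = fun i => L i + center a E i := by
    rw [hstep, center_add, center_of_sum_eq_zero hLsum]
  have hEsq : weightedSq a (center a E) ≤ ω ^ 2 * (∑ i, 1 / a i) * weightedSq b y ^ 2 := by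
    refine (weightedSq_center_le hM.left_pos E).trans ?_
    rw [weightedSq, Finset.mul_sum, Finset.sum_mul]
    refine Finset.sum_le_sum fun i _ => ?_
    obtain ⟨h1, h2⟩ := log_sum_exp_bounds hM hpos hy1 i
    have hai := hM.left_pos i
    simp only [hE]
    calc _ ≤ a i * (ω ^ 2 * (weightedSq b y / a i) ^ 2) := by
          rw [mul_pow, neg_sq]
          gcongr
      _ = _ := by field_simp
  rw [hcen]
  have hadd := lyapunov_add_right_le hM.symm h.symm hθ hr hω hc hτ hy hLsum
    (sum_mul_center hM.left_pos E)
  have hlin := lyapunov_linear_step_le (ω := ω) hM hq x y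
  rw [← hL, ← hV] at hlin
  have hy2 : weightedSq b y ^ 2 ≤ V ^ 2 / c ^ 2 := by
    rw [le_div_iff₀ (by positivity), ← mul_pow]
    gcongr
    linarith
  have hquad : (1 + 1 / τ) * ((r + q) * weightedSq a (center a E)) ≤ G * V ^ 2 := by
    calc _ ≤ (1 + 1 / τ) * ((r + q) * (ω ^ 2 * (∑ i, 1 / a i) * (V ^ 2 / c ^ 2))) := by
          gcongr
          exact hEsq.trans (by gcongr)
      _ = _ := by rw [hG]; ring
  have hGV : G * V ≤ (R - r) / 2 := by
    have h1 := hv.trans (min_le_right _ _)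
    rw [le_div_iff₀ (by positivity)] at h1
    nlinarith
  have hτr : (1 + τ) * r = r + (R - r) / 2 := by rw [hτdef]; field_simp
  calc _ ≤ (1 + τ) * (r * V) + G * V ^ 2 := by
        refine hadd.trans (add_le_add ?_ hquad)
        gcongr
    _ = (1 + τ) * r * V + G * V * V := by ring
    _ ≤ (r + (R - r) / 2) * V + (R - r) / 2 * V := by rw [hτr]; gcongr
    _ = R * V := by ring


theorem sinkhornRate_stability {θ ω r : ℝ} (hθ0 : 0 < θ) (hθ1 : θ < 1) (hω0 : 0 < ω)
    (hω2 : ω < 2) (hr : sinkhornRate θ ω < r) :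
    0 < r ∧ ω - 1 ≤ r ∧ ω * θ * √r < r + (ω - 1) := by
  have hθsq : 0 < 1 - θ ^ 2 := by nlinarith
  have hc := Real.sq_sqrt hθsq.le
  have hc0 : 0 < √(1 - θ ^ 2) := Real.sqrt_pos.2 hθsq
  have hc1 : √(1 - θ ^ 2) < 1 := by
    rw [Real.sqrt_lt' one_pos]; nlinarith [sq_pos_of_pos hθ0]
  set c := √(1 - θ ^ 2)
  have hfac : ω ^ 2 * θ ^ 2 - 4 * (ω - 1) = (2 - ω * (1 + c)) * (2 - ω + ω * c) := by
    linear_combination ω ^ 2 * hc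
  have hpos : 0 < 2 - ω + ω * c := by nlinarith
  unfold sinkhornRate at hr
  split_ifs at hr with hω
  · rw [le_div_iff₀ (by positivity)] at hω
    have hD : 0 ≤ ω ^ 2 * θ ^ 2 - 4 * (ω - 1) := by
      rw [hfac]; exact mul_nonneg (by linarith) hpos.le
    have hs := Real.sq_sqrt hD
    have hs0 := Real.sqrt_nonneg (ω ^ 2 * θ ^ 2 - 4 * (ω - 1))
    set s := √(ω ^ 2 * θ ^ 2 - 4 * (ω - 1))
    have hωθ : 0 < ω * θ := mul_pos hω0 hθ0
    have hr0 : 0 < r := lt_of_le_of_lt (by positivity) hr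
    have ht := Real.sq_sqrt hr0.le
    have hlt : (ω * θ + s) / 2 < √r := by
      apply Real.lt_sqrt_of_sq_lt
      linarith
    refine ⟨hr0, by nlinarith, ?_⟩
    nlinarith [mul_pos (sub_pos.2 hlt) (show 0 < √r - (ω * θ - s) / 2 by linarith)]
  · rw [not_le, div_lt_iff₀ (by positivity)] at hω
    have hω1 : 1 < ω := by nlinarith
    have hr0 : 0 < r := by linarith
    have ht := Real.sq_sqrt hr0.le
    have hD : (2 - ω * (1 + c)) * (2 - ω + ω * c) < 0 :=
      mul_neg_of_neg_of_pos (by linarith) hpos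
    refine ⟨hr0, hr.le, ?_⟩
    nlinarith [sq_nonneg (2 * √r - ω * θ)]

theorem dotProduct_Hmat_mulVec {m n : ℕ} (K : Matrix (Fin m) (Fin n) ℝ) (a : Fin m → ℝ)
    (b : Fin n → ℝ) (u : Fin m → ℝ) (v : Fin n → ℝ) (ha : ∀ i, 0 < a i) (hb : ∀ j, 0 < b j)
    (x : Fin m → ℝ) :
    (fun i => √(a i) * x i) ⬝ᵥ (Hmat K a b u v).mulVec (fun i => √(a i) * x i) =
      weightedSq b (fun j => ∑ i, u i * K i j * v j / b j * x i) := by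
  have e (i : Fin m) (k : ℝ) : √(a i) * x i * (u i / √(a i)) * k = u i * k * x i := by
    have := (Real.sqrt_pos.2 (ha i)).ne'
    field_simp
  simp only [Hmat, ← Matrix.mulVec_mulVec]
  rw [Matrix.dotProduct_mulVec, Matrix.dotProduct_mulVec, weightedSq]
  simp only [dotProduct]
  refine Finset.sum_congr rfl fun j _ => ?_
  rw [Matrix.mulVec_diagonal, Matrix.mulVec_transpose]
  simp only [Matrix.vecMul, dotProduct]
  have e1 : ∑ i, (∑ k, √(a k) * x k * Matrix.diagonal (fun i => u i / √(a i)) k i) * K i j =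
      ∑ i, u i * K i j * x i := by
    refine Finset.sum_congr rfl fun i _ => ?_
    rw [Finset.sum_eq_single i (fun k _ hk => by simp [Matrix.diagonal_apply_ne _ hk]) (by simp),
      Matrix.diagonal_apply_eq, e]
  have e2 : ∑ i, (Matrix.diagonal (fun i => u i / √(a i))).mulVec (fun i => √(a i) * x i) i * K i j =
      ∑ i, u i * K i j * x i := by
    refine Finset.sum_congr rfl fun i _ => ?_
    rw [Matrix.mulVec_diagonal, ← e]
    ring
  have e3 : ∑ i, u i * K i j * v j / b j * x i = v j / b j * ∑ i, u i * K i j * x i := by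
    rw [Finset.mul_sum]
    exact Finset.sum_congr rfl fun i _ => by ring
  have := (hb j).ne'
  rw [e1, e2, e3]
  field_simp

theorem correlationLE_sqrt_thetaSq {m n : ℕ} (K : Matrix (Fin m) (Fin n) ℝ) (a : Fin m → ℝ)
    (b : Fin n → ℝ) (u : Fin m → ℝ) (v : Fin n → ℝ) (ha : ∀ i, 0 < a i) (hb : ∀ j, 0 < b j)
    (hθ : 0 < thetaSq K a b u v) :
    CorrelationLE √(thetaSq K a b u v) a b (fun i j => u i * K i j * v j) := by
  intro x y hx _
  rw [Real.sq_sqrt hθ.le]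
  have hH := dotProduct_Hmat_mulVec K a b u v ha hb x
  set w : Fin m → ℝ := fun i => √(a i) * x i with hw
  have hww : w ⬝ᵥ w = weightedSq a x := by
    simp only [dotProduct, weightedSq, hw]
    refine Finset.sum_congr rfl fun i _ => ?_
    have := Real.mul_self_sqrt (ha i).le
    linear_combination x i ^ 2 * this
  set g : Fin n → ℝ := fun j => ∑ i, u i * K i j * v j / b j * x i
  have hg : weightedSq b g ≤ thetaSq K a b u v * weightedSq a x := by
    by_cases hw0 : w = 0
    · rw [← hH, ← hww, hw0]; simp
    · have hpos : 0 < w ⬝ᵥ w :=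
        lt_of_le_of_ne (by rw [hww]; exact weightedSq_nonneg ha x)
          (Ne.symm (mt dotProduct_self_eq_zero.1 hw0))
      rw [← hH, ← hww, ← div_le_iff₀ hpos]
      have hbdd : BddAbove {r : ℝ | ∃ w : Fin m → ℝ, w ≠ 0 ∧
          (w ⬝ᵥ fun i => Real.sqrt (a i)) = 0 ∧
          r = w ⬝ᵥ (Hmat K a b u v).mulVec w / (w ⬝ᵥ w)} := by
        by_contra hn
        rw [thetaSq, Real.sSup_of_not_bddAbove hn] at hθ
        exact lt_irrefl _ hθ
      refine le_csSup hbdd ⟨w, hw0, ?_, rfl⟩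
      rw [← hx]
      refine Finset.sum_congr rfl fun i _ => ?_
      have := Real.mul_self_sqrt (ha i).le
      simp only [hw]
      linear_combination x i * this
  have hform : couplingForm (fun i j => u i * K i j * v j) x y = ∑ j, b j * y j * g j := by
    rw [← couplingForm_swap]
    refine Finset.sum_congr rfl fun j _ => ?_
    have := (hb j).ne'
    rw [Finset.mul_sum, Finset.mul_sum]
    exact Finset.sum_congr rfl fun i _ => by field_simp
  have hcs : couplingForm (fun i j => u i * K i j * v j) x y ^ 2 ≤
      weightedSq b y * weightedSq b g := by
    rw [hform]
    exact Finset.sum_sq_le_sum_mul_sum_of_sq_le_mul _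
      (fun j _ => mul_nonneg (hb j).le (sq_nonneg _))
      (fun j _ => mul_nonneg (hb j).le (sq_nonneg _)) (fun j _ => le_of_eq (by ring))
  refine hcs.trans ?_
  have := mul_le_mul_of_nonneg_left hg (weightedSq_nonneg hb y)
  linarith

theorem div_eq_exp_log_sub {m : ℕ} {x y : Fin m → ℝ} (hx : ∀ i, 0 < x i) (hy : ∀ i, 0 < y i)
    (i j : Fin m) : x i * y j / (x j * y i) =
      Real.exp (Real.log (x i / y i) - Real.log (x j / y j)) := by
  have h1 := hx i
  have h2 := hx j
  have h3 := hy i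
  have h4 := hy j
  rw [Real.exp_sub, Real.exp_log (by positivity), Real.exp_log (by positivity)]
  field_simp

theorem log_sub_le_dH {m : ℕ} {x y : Fin m → ℝ} (hx : ∀ i, 0 < x i) (hy : ∀ i, 0 < y i)
    (i j : Fin m) : Real.log (x i / y i) - Real.log (x j / y j) ≤ dH x y := by
  have h : x i * y j / (x j * y i) ≤ ⨆ i, ⨆ j, x i * y j / (x j * y i) :=
    (le_ciSup (f := fun j => x i * y j / (x j * y i)) (Set.finite_range _).bddAbove j).trans
      (le_ciSup (f := fun i => ⨆ j, x i * y j / (x j * y i)) (Set.finite_range _).bddAbove i)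
  rw [div_eq_exp_log_sub hx hy] at h
  exact (Real.le_log_iff_exp_le ((Real.exp_pos _).trans_le h)).2 h

theorem dH_le {m : ℕ} [Nonempty (Fin m)] {x y : Fin m → ℝ} (hx : ∀ i, 0 < x i)
    (hy : ∀ i, 0 < y i) {D : ℝ}
    (h : ∀ i j, Real.log (x i / y i) - Real.log (x j / y j) ≤ D) : dH x y ≤ D := by
  have h1 : ⨆ i, ⨆ j, x i * y j / (x j * y i) ≤ Real.exp D :=
    ciSup_le fun i => ciSup_le fun j => by
      rw [div_eq_exp_log_sub hx hy]
      exact Real.exp_le_exp.2 (h i j)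
  have i₀ := Classical.arbitrary (Fin m)
  have h2 : 0 < ⨆ i, ⨆ j, x i * y j / (x j * y i) := by
    refine lt_of_lt_of_le (b := x i₀ * y i₀ / (x i₀ * y i₀)) (div_pos (mul_pos (hx _) (hy _))
      (mul_pos (hx _) (hy _))) ?_
    exact (le_ciSup (f := fun j => x i₀ * y j / (x j * y i₀)) (Set.finite_range _).bddAbove i₀).trans
      (le_ciSup (f := fun i => ⨆ j, x i * y j / (x j * y i)) (Set.finite_range _).bddAbove i₀)
  exact (Real.log_le_iff_le_exp h2).2 h1

theorem dH_le_of_weightedSq {m : ℕ} [Nonempty (Fin m)] {a x y : Fin m → ℝ} (ha : ∀ i, 0 < a i)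
    (hx : ∀ i, 0 < x i) (hy : ∀ i, 0 < y i) {S : ℝ}
    (h : weightedSq a (center a fun i => Real.log (x i / y i)) ≤ S) :
    dH x y ≤ 2 * √((∑ i, 1 / a i) * S) := by
  have key : ∀ i, |center a (fun i => Real.log (x i / y i)) i| ≤ √((∑ i, 1 / a i) * S) := by
    intro i
    apply Real.abs_le_sqrt
    have h1 := (le_weightedSq ha (center a fun i => Real.log (x i / y i)) i).trans h
    have h2 : 1 / a i ≤ ∑ i, 1 / a i :=
      Finset.single_le_sum (f := fun i => 1 / a i) (fun k _ => (one_div_pos.2 (ha k)).le)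
        (Finset.mem_univ i)
    have hS : 0 ≤ S := (weightedSq_nonneg ha _).trans h
    have h3 := mul_le_mul_of_nonneg_right h2 hS
    have h4 := mul_le_mul_of_nonneg_left h1 (one_div_pos.2 (ha i)).le
    rw [← mul_assoc, one_div_mul_cancel (ha i).ne', one_mul] at h4
    exact h4.trans h3
  refine dH_le hx hy fun i j => ?_
  have h1 := (abs_le.1 (key i)).2
  have h2 := (abs_le.1 (key j)).1
  simp only [center] at h1 h2
  linarith

theorem weightedSq_center_le_dH {m : ℕ} {a x y : Fin m → ℝ} (ha : ∀ i, 0 < a i)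
    (hx : ∀ i, 0 < x i) (hy : ∀ i, 0 < y i) {δ : ℝ} (h : dH x y ≤ δ) :
    weightedSq a (center a fun i => Real.log (x i / y i)) ≤ (∑ i, a i) * δ ^ 2 := by
  rw [weightedSq, Finset.sum_mul]
  refine Finset.sum_le_sum fun i _ => mul_le_mul_of_nonneg_left ?_ (ha i).le
  have hs : 0 < ∑ i, a i := Finset.sum_pos (fun i _ => ha i) ⟨i, Finset.mem_univ i⟩
  have hd (j k) := (log_sub_le_dH hx hy j k).trans h
  apply sq_le_sq'
  · rw [center, neg_le_sub_iff_le_add, div_le_iff₀ hs, Finset.mul_sum]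
    refine Finset.sum_le_sum fun k _ => ?_
    rw [mul_comm]
    exact mul_le_mul_of_nonneg_right (by linarith [hd k i]) (ha k).le
  · rw [center, sub_le_comm, le_div_iff₀ hs, Finset.mul_sum]
    refine Finset.sum_le_sum fun k _ => ?_
    rw [mul_comm (a k)]
    exact mul_le_mul_of_nonneg_right (by linarith [hd i k]) (ha k).le

theorem log_sinkhorn_update {m n : ℕ} {K : Matrix (Fin m) (Fin n) ℝ} (hK : ∀ i j, 0 < K i j)
    [Nonempty (Fin n)] {a : Fin m → ℝ} (ha : ∀ i, 0 < a i) {u₀ u u' : Fin m → ℝ}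
    {v₀ v : Fin n → ℝ} (hu₀ : ∀ i, 0 < u₀ i) (hv₀ : ∀ j, 0 < v₀ j) (hu : ∀ i, 0 < u i)
    (hv : ∀ j, 0 < v j) {ω : ℝ}
    (h : ∀ i, u' i = u i ^ (1 - ω) * (a i / K.mulVec v i) ^ ω) :
    (∀ i, 0 < u' i) ∧ (fun i => Real.log (u' i / u₀ i)) =
      logStep (ω - 1) ω a (fun i j => u₀ i * K i j * v₀ j) (fun i => Real.log (u i / u₀ i))
        (fun j => Real.log (v j / v₀ j)) := by
  have hS (i) : 0 < K.mulVec v i :=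
    Finset.sum_pos (fun j _ => mul_pos (hK i j) (hv j)) Finset.univ_nonempty
  have hpos : ∀ i, 0 < u' i := fun i => by
    rw [h]
    exact mul_pos (Real.rpow_pos_of_pos (hu i) _) (Real.rpow_pos_of_pos (div_pos (ha i) (hS i)) _)
  refine ⟨hpos, funext fun i => ?_⟩
  have e : ∑ j, u₀ i * K i j * v₀ j / a i * Real.exp (Real.log (v j / v₀ j)) =
      u₀ i * K.mulVec v i / a i := by
    simp only [Matrix.mulVec, dotProduct, Finset.mul_sum, Finset.sum_div]
    refine Finset.sum_congr rfl fun j _ => ?_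
    have := hv₀ j
    rw [Real.exp_log (div_pos (hv j) (hv₀ j))]
    field_simp
  have h1 := (hu₀ i).ne'
  have h2 := (hu i).ne'
  have h3 := (hS i).ne'
  have h4 := (ha i).ne'
  rw [logStep, e, Real.log_div (hpos i).ne' h1, h, Real.log_mul (Real.rpow_pos_of_pos (hu i) _).ne'
    (Real.rpow_pos_of_pos (div_pos (ha i) (hS i)) _).ne', Real.log_rpow (hu i),
    Real.log_rpow (div_pos (ha i) (hS i)), Real.log_div h4 h3, Real.log_div h2 h1,
    Real.log_div (mul_ne_zero h1 h3) h4, Real.log_mul h1 h3]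
  ring

end OverrelaxedSinkhorn

theorem local_convergence_of_overrelaxed_Sinkhorn
    {m n : ℕ} (K : Matrix (Fin m) (Fin n) ℝ) (hK : ∀ i j, 0 < K i j)
    (a : Fin m → ℝ) (b : Fin n → ℝ) (ha : ∀ i, 0 < a i) (hb : ∀ j, 0 < b j)
    (ustar : Fin m → ℝ) (vstar : Fin n → ℝ)
    (hustar : ∀ i, 0 < ustar i) (hvstar : ∀ j, 0 < vstar j)
    (hsol1 : ∀ i, ustar i * K.mulVec vstar i = a i)
    (hsol2 : ∀ j, vstar j * Kᵀ.mulVec ustar j = b j)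
    (hθ0 : 0 < thetaSq K a b ustar vstar) (hθ1 : thetaSq K a b ustar vstar < 1)
    (ω : ℝ) (hω0 : 0 < ω) (hω2 : ω < 2)
    (ε : ℝ) (hε : 0 < ε)
    (hερ : sinkhornRate (Real.sqrt (thetaSq K a b ustar vstar)) ω + ε < 1) :
    ∃ δ : ℝ, 0 < δ ∧ ∃ C : ℝ, 0 < C ∧
      ∀ u : ℕ → Fin m → ℝ, ∀ v : ℕ → Fin n → ℝ,
        (∀ i, 0 < u 0 i) → (∀ j, 0 < v 0 j) →
        (∀ ℓ i, u (ℓ + 1) i = u ℓ i ^ (1 - ω) * (a i / K.mulVec (v ℓ) i) ^ ω) →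
        (∀ ℓ j, v (ℓ + 1) j = v ℓ j ^ (1 - ω) * (b j / Kᵀ.mulVec (u (ℓ + 1)) j) ^ ω) →
        dH (u 0) ustar ≤ δ → dH (v 0) vstar ≤ δ →
        ∀ ℓ : ℕ, dH (u ℓ) ustar + dH (v ℓ) vstar ≤
          C * (sinkhornRate (Real.sqrt (thetaSq K a b ustar vstar)) ω + ε) ^ ℓ := by
  have : Nonempty (Fin m) := by
    by_contra hm
    rw [not_nonempty_iff] at hm
    refine hθ0.ne' ?_
    rw [thetaSq]
    convert Real.sSup_empty
    refine Set.eq_empty_iff_forall_notMem.2 ?_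
    rintro r ⟨w, hw, -⟩
    exact hw (Subsingleton.elim _ _)
  have : Nonempty (Fin n) := by
    by_contra hn
    rw [not_nonempty_iff] at hn
    have i := Classical.arbitrary (Fin m)
    have := hsol1 i
    simp only [Matrix.mulVec, dotProduct, Finset.univ_eq_empty, Finset.sum_empty, mul_zero] at this
    exact (ha i).ne this
  set θ := √(thetaSq K a b ustar vstar) with hθ
  have hcorr := correlationLE_sqrt_thetaSq K a b ustar vstar ha hb hθ0
  rw [← hθ] at hcorr
  have hθpos : 0 < θ := Real.sqrt_pos.2 hθ0
  have hθlt : θ < 1 := by rw [hθ, Real.sqrt_lt' one_pos]; simpa using hθ1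
  set M : Fin m → Fin n → ℝ := fun i j => ustar i * K i j * vstar j with hMdef
  have hMpos : ∀ i j, 0 < M i j := fun i j => mul_pos (mul_pos (hustar i) (hK i j)) (hvstar j)
  have hM : IsCoupling a b M := by
    refine ⟨ha, hb, fun i j => (hMpos i j).le, fun i => ?_, fun j => ?_⟩
    · rw [← hsol1, Matrix.mulVec, dotProduct, Finset.mul_sum]
      exact Finset.sum_congr rfl fun j _ => by simp only [hMdef]; ring
    · rw [← hsol2, Matrix.mulVec, dotProduct, Finset.mul_sum]
      exact Finset.sum_congr rfl fun i _ => by simp only [hMdef, Matrix.transpose_apply]; ring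
  set R := sinkhornRate θ ω + ε with hR
  set r := sinkhornRate θ ω + ε / 2 with hr
  obtain ⟨hr0, hqr, hgap⟩ := sinkhornRate_stability (r := r) hθpos hθlt hω0 hω2 (by linarith)
  have hrR : r < R := by linarith
  have hR0 : 0 < R := hr0.trans hrR
  obtain ⟨v₁, hv₁, hstep₁⟩ := exists_lyapunov_logStep_le hM hMpos hcorr hθpos.le hr0 hω0 hqr hgap hrR
  obtain ⟨v₂, hv₂, hstep₂⟩ := exists_lyapunov_logStep_le hM.symm (fun j i => hMpos i j)
    hcorr.symm hθpos.le hr0 hω0 hqr hgap hrR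
  set V₀ := min v₁ v₂
  have hV₀ : 0 < V₀ := lt_min hv₁ hv₂
  set c := r + (ω - 1) - ω * θ * √r with hc
  have hc0 : 0 < c := sub_pos.2 hgap
  have hrq : 0 < r + (ω - 1) := lt_of_le_of_lt (by positivity) hgap
  have hsa : 0 < ∑ i, a i := Finset.sum_pos (fun i _ => ha i) Finset.univ_nonempty
  have hsb : 0 < ∑ j, b j := Finset.sum_pos (fun j _ => hb j) Finset.univ_nonempty
  set W := (r + (ω - 1) + ω * θ * √r) * (r * (∑ i, a i) + ∑ j, b j) with hW
  have hW0 : 0 < W := by positivity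
  refine ⟨√(V₀ / W), Real.sqrt_pos.2 (by positivity),
    2 * √((∑ i, 1 / a i) * (V₀ / (c * r))) + 2 * √((∑ j, 1 / b j) * (V₀ / c)) + 1,
    by positivity, ?_⟩
  intro u v hu0 hv0 hu hv hdu hdv
  have hKt : ∀ j i, 0 < Kᵀ j i := fun j i => hK i j
  have hMt : (fun j i => vstar j * Kᵀ j i * ustar i) = fun j i => M i j := by
    funext j i; simp only [hMdef, Matrix.transpose_apply]; ring
  have hpos : ∀ k, (∀ i, 0 < u k i) ∧ ∀ j, 0 < v k j := by
    intro k
    induction k with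
    | zero => exact ⟨hu0, hv0⟩
    | succ k ih =>
      have h1 := (log_sinkhorn_update hK ha hustar hvstar ih.1 ih.2 (hu k)).1
      exact ⟨h1, (log_sinkhorn_update hKt hb hvstar hustar ih.2 h1 (hv k)).1⟩
  set X : ℕ → Fin m → ℝ := fun k => center a fun i => Real.log (u k i / ustar i) with hX
  set Y : ℕ → Fin n → ℝ := fun k => center b fun j => Real.log (v k j / vstar j) with hY
  have hX0 (k) : ∑ i, a i * X k i = 0 := sum_mul_center ha _
  have hY0 (k) : ∑ j, b j * Y k j = 0 := sum_mul_center hb _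
  have hXs (k) : X (k + 1) = center a (logStep (ω - 1) ω a M (X k) (Y k)) := by
    rw [center_logStep_center hM hMpos]
    exact congrArg (center a) (log_sinkhorn_update hK ha hustar hvstar (hpos k).1 (hpos k).2 (hu k)).2
  have hYs (k) : Y (k + 1) =
      center b (logStep (ω - 1) ω b (fun j i => M i j) (Y k) (X (k + 1))) := by
    rw [center_logStep_center hM.symm (fun j i => hMpos i j), ← hMt]
    exact congrArg (center b)
      (log_sinkhorn_update hKt hb hvstar hustar (hpos k).2 (hpos (k + 1)).1 (hv k)).2
  have hbd (k) := lyapunov_bounds (q := ω - 1) hM hcorr hθpos.le hr0 hω0 (hX0 k) (hY0 k)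
  have hV (k) : lyapunov r (ω - 1) ω a b M (X k) (Y k) ≤ (R ^ k) ^ 2 * V₀ := by
    induction k with
    | zero =>
      refine (hbd 0).2.trans ?_
      have h1 := weightedSq_center_le_dH ha hu0 hustar hdu
      have h2 := weightedSq_center_le_dH hb hv0 hvstar hdv
      rw [Real.sq_sqrt (by positivity)] at h1 h2
      calc _ ≤ (r + (ω - 1) + ω * θ * √r) *
            (r * ((∑ i, a i) * (V₀ / W)) + (∑ j, b j) * (V₀ / W)) := by gcongr
        _ = W * (V₀ / W) := by rw [hW]; ring
        _ = (R ^ 0) ^ 2 * V₀ := by field_simp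
    | succ k ih =>
      have hRk : (R ^ k) ^ 2 ≤ 1 := pow_le_one₀ (by positivity) (pow_le_one₀ hR0.le hερ.le)
      have ih' : lyapunov r (ω - 1) ω a b M (X k) (Y k) ≤ V₀ :=
        ih.trans (mul_le_of_le_one_left hV₀.le hRk)
      have h1 := hstep₁ _ _ (hX0 k) (hY0 k) (ih'.trans (min_le_left _ _))
      rw [← hXs] at h1
      have h1' : lyapunov r (ω - 1) ω b a (fun j i => M i j) (Y k) (X (k + 1)) ≤ V₀ :=
        h1.trans ((mul_le_mul_of_nonneg_left ih' hR0.le).trans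
          (mul_le_of_le_one_left hV₀.le hερ.le))
      have h2 := hstep₂ _ _ (hY0 k) (hX0 (k + 1)) (h1'.trans (min_le_right _ _))
      rw [← hYs] at h2
      calc _ ≤ R * (R * ((R ^ k) ^ 2 * V₀)) := h2.trans (by gcongr; exact h1.trans (by gcongr))
        _ = (R ^ (k + 1)) ^ 2 * V₀ := by ring
  intro k
  have hlow := (hbd k).1.trans (hV k)
  rw [← hc] at hlow
  have hXk := weightedSq_nonneg ha (X k)
  have hYk := weightedSq_nonneg hb (Y k)
  have hXle : weightedSq a (X k) ≤ (R ^ k) ^ 2 * (V₀ / (c * r)) := by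
    rw [← mul_div_assoc, le_div_iff₀ (by positivity)]
    nlinarith [mul_nonneg hc0.le hYk]
  have hYle : weightedSq b (Y k) ≤ (R ^ k) ^ 2 * (V₀ / c) := by
    rw [← mul_div_assoc, le_div_iff₀ hc0]
    nlinarith [mul_nonneg (mul_pos hc0 hr0).le hXk]
  have h1 := dH_le_of_weightedSq ha (hpos k).1 hustar hXle
  have h2 := dH_le_of_weightedSq hb (hpos k).2 hvstar hYle
  have hRk : 0 ≤ R ^ k := by positivity
  rw [mul_left_comm, Real.sqrt_mul (by positivity), Real.sqrt_sq hRk] at h1 h2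
  linarith
end
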